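/- Let p be a prime and let a : ℕ → ℚ_p be a sequence with ‖a n‖ → 0 as n → ∞. Suppose N ∈ ℕ satisfies ‖a N‖ = sup over n of ‖a n‖, ‖a N‖ ≠ 0, and ‖a n‖ < ‖a N‖ for all n > N. Then the set {x ∈ ℤ_p : ∑' n, a n · xⁿ = 0} has cardinality at most N. -/

import Mathlib

open Filter

section StrassmannAux

variable {p : ℕ} [Fact p.Prime]

lemma strassmann_summable {f : ℕ → ℚ_[p]} (hf : Tendsto (fun n => ‖f n‖) atTop (nhds 0)) :
    Summable f := by
  apply NonarchimedeanAddGroup.summable_of_tendsto_cofinite_zero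
  rw [Nat.cofinite_eq_atTop]
  exact tendsto_zero_iff_norm_tendsto_zero.2 hf

lemma strassmann_tsum_le {f : ℕ → ℚ_[p]} {r : ℝ} (hr : 0 ≤ r) (h : ∀ n, ‖f n‖ ≤ r) :
    ‖∑' n, f n‖ ≤ r := by
  exact IsUltrametricDist.norm_tsum_le_of_forall_le_of_nonneg hr h

lemma strassmann_tsum_lt {f : ℕ → ℚ_[p]} {r : ℝ} (hr : 0 < r)
    (hf : Tendsto (fun n => ‖f n‖) atTop (nhds 0)) (h : ∀ n, ‖f n‖ < r) :
    ‖∑' n, f n‖ < r := by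
  obtain ⟨M, hM⟩ := eventually_atTop.1 (hf.eventually_le_const (half_pos hr))
  have key : ∀ M : ℕ, ∃ s, 0 ≤ s ∧ s < r ∧ ∀ n < M, ‖f n‖ ≤ s := by
    intro M
    induction M with
    | zero => exact ⟨0, le_rfl, hr, by simp⟩
    | succ m ih =>
      obtain ⟨s, h0, h1, h2⟩ := ih
      refine ⟨max s ‖f m‖, le_max_of_le_left h0, max_lt h1 (h m), fun n hn => ?_⟩
      rcases Nat.lt_succ_iff_lt_or_eq.1 hn with h3 | rfl
      · exact le_max_of_le_left (h2 n h3)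
      · exact le_max_right _ _
  obtain ⟨s, h0, h1, h2⟩ := key M
  refine lt_of_le_of_lt (strassmann_tsum_le (r := max s (r / 2)) (le_max_of_le_left h0) ?_)
    (max_lt h1 (half_lt_self hr))
  intro n
  rcases lt_or_ge n M with h3 | h3
  · exact le_max_of_le_left (h2 n h3)
  · exact le_max_of_le_right (hM n h3)

lemma strassmann_term_le (u : ℚ_[p]) (x : ℤ_[p]) (n : ℕ) : ‖u * (x : ℚ_[p]) ^ n‖ ≤ ‖u‖ := by
  rw [norm_mul, norm_pow]
  exact mul_le_of_le_one_right (norm_nonneg _) (pow_le_one₀ (norm_nonneg _) x.2)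

lemma strassmann_term_tendsto {a : ℕ → ℚ_[p]} (ha : Tendsto (fun n => ‖a n‖) atTop (nhds 0))
    (x : ℤ_[p]) : Tendsto (fun n => ‖a n * (x : ℚ_[p]) ^ n‖) atTop (nhds 0) :=
  squeeze_zero (fun _ => norm_nonneg _) (fun n => strassmann_term_le _ _ _) ha

lemma strassmann_aux (N : ℕ) : ∀ (a : ℕ → ℚ_[p])
    (_ : Tendsto (fun n => ‖a n‖) atTop (nhds 0))
    (_ : ∀ n, ‖a n‖ ≤ ‖a N‖) (_ : 0 < ‖a N‖)
    (_ : ∀ n : ℕ, N < n → ‖a n‖ < ‖a N‖),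
    {x : ℤ_[p] | ∑' n : ℕ, a n * (x : ℚ_[p]) ^ n = 0}.encard ≤ N := by
  induction N with
  | zero =>
    intro a ha hle h0 hlt
    simp only [Nat.cast_zero, nonpos_iff_eq_zero, Set.encard_eq_zero]
    ext x
    simp only [Set.mem_setOf_eq, Set.mem_empty_iff_false, iff_false]
    intro hx
    rw [(strassmann_summable (strassmann_term_tendsto ha x)).tsum_eq_zero_add] at hx
    have h1 := strassmann_tsum_lt h0 ((tendsto_add_atTop_iff_nat 1).2 (strassmann_term_tendsto ha x))
      (fun n => (strassmann_term_le _ _ _).trans_lt (hlt (n + 1) (by omega)))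
    rw [pow_zero, mul_one] at hx
    rw [← neg_eq_of_add_eq_zero_right hx, norm_neg] at h1
    exact lt_irrefl _ h1
  | succ N ih =>
    intro a ha hle h0 hlt
    rcases Set.eq_empty_or_nonempty
      {x : ℤ_[p] | ∑' n : ℕ, a n * (x : ℚ_[p]) ^ n = 0} with he | ⟨c, hc⟩
    · rw [he]; simp
    have hc' : ∑' n : ℕ, a n * (c : ℚ_[p]) ^ n = 0 := hc
    set b : ℕ → ℚ_[p] := fun k => ∑' j, a (j + (k + 1)) * (c : ℚ_[p]) ^ j with hb
    have hat : ∀ k, Tendsto (fun j => ‖a (j + k)‖) atTop (nhds 0) := fun k =>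
      (tendsto_add_atTop_iff_nat (f := fun n => ‖a n‖) k).2 ha
    have hrec0 : ∀ k, ∑' j, a (j + k) * (c : ℚ_[p]) ^ j = a k + c * b k := by
      intro k
      rw [(strassmann_summable (strassmann_term_tendsto (a := fun j => a (j + k))
        (hat k) c)).tsum_eq_zero_add, hb, ← tsum_mul_left]
      simp only [zero_add, pow_zero, mul_one]
      congr 2
      ext j
      rw [show j + 1 + k = j + (k + 1) by ring]
      ring
    have hrec : ∀ k, b k = a (k + 1) + c * b (k + 1) := fun k => hrec0 (k + 1)
    have hroot : a 0 + c * b 0 = 0 := by rw [← hrec0 0]; exact hc'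
    have hble : ∀ k, ∀ r : ℝ, 0 ≤ r → (∀ n, k < n → ‖a n‖ ≤ r) → ‖b k‖ ≤ r := fun k r hr h =>
      strassmann_tsum_le hr fun j => (strassmann_term_le _ _ _).trans (h _ (by omega))
    have hblt : ∀ k, N < k → ‖b k‖ < ‖a (N + 1)‖ := fun k hk =>
      strassmann_tsum_lt h0 (strassmann_term_tendsto (a := fun j => a (j + (k + 1)))
        (hat (k + 1)) c) fun j => (strassmann_term_le _ _ _).trans_lt (hlt _ (by omega))
    have hbN : ‖b N‖ = ‖a (N + 1)‖ := by
      rw [hrec N]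
      have h1 : ‖(c : ℚ_[p]) * b (N + 1)‖ < ‖a (N + 1)‖ := by
        rw [norm_mul]
        exact (mul_le_of_le_one_left (norm_nonneg _) c.2).trans_lt (hblt _ (by omega))
      rw [IsUltrametricDist.norm_add_eq_max_of_norm_ne_norm h1.ne', max_eq_left h1.le]
    have hbt : Tendsto (fun n => ‖b n‖) atTop (nhds 0) := by
      rw [Metric.tendsto_atTop]
      intro ε hε
      obtain ⟨M, hM⟩ := eventually_atTop.1 (ha.eventually_le_const (half_pos hε))
      refine ⟨M, fun n hn => ?_⟩
      have := hble n (ε / 2) (half_pos hε).le fun m hm => hM m (by omega)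
      rw [Real.dist_0_eq_abs, abs_of_nonneg (norm_nonneg _)]
      linarith
    have hS := ih b hbt (fun k => hbN ▸ hble k _ h0.le fun n _ => hle n) (hbN ▸ h0)
      (fun k hk => hbN ▸ hblt k hk)
    have hsub : {x : ℤ_[p] | ∑' n : ℕ, a n * (x : ℚ_[p]) ^ n = 0} ⊆
        insert c {x : ℤ_[p] | ∑' n : ℕ, b n * (x : ℚ_[p]) ^ n = 0} := by
      intro x hx
      have hx' : ∑' n : ℕ, a n * (x : ℚ_[p]) ^ n = 0 := hx
      have sa := strassmann_summable (strassmann_term_tendsto ha x)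
      have sb := strassmann_summable (strassmann_term_tendsto hbt x)
      have sa1 := (summable_nat_add_iff 1).2 sa
      have sb1 := (summable_nat_add_iff 1).2 sb
      have e1 := sa.tsum_eq_zero_add
      have e2 := sb.tsum_eq_zero_add
      have e3 : (x : ℚ_[p]) * ∑' n : ℕ, b n * (x : ℚ_[p]) ^ n =
          ∑' n : ℕ, a (n + 1) * (x : ℚ_[p]) ^ (n + 1) +
            c * ∑' n : ℕ, b (n + 1) * (x : ℚ_[p]) ^ (n + 1) := by
        rw [← tsum_mul_left, ← tsum_mul_left, ← sa1.tsum_add (sb1.mul_left _)]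
        congr 1
        ext n
        rw [hrec n]
        ring
      have e4 : ((x : ℚ_[p]) - c) * ∑' n : ℕ, b n * (x : ℚ_[p]) ^ n = 0 := by
        rw [hx'] at e1
        rw [pow_zero, mul_one] at e1 e2
        linear_combination e3 - e1 - c * e2 - hroot
      rcases mul_eq_zero.1 e4 with h | h
      · left
        exact Subtype.ext (sub_eq_zero.1 h)
      · right
        exact h
    calc _ ≤ _ := Set.encard_le_encard hsub
      _ ≤ _ := Set.encard_insert_le _ _
      _ ≤ _ := by push_cast; gcongr

end StrassmannAux

/-- Quantitative Strassmann bound: if `N` is the largest index at which the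
(attained, nonzero) supremum of the coefficient norms occurs, then the power series
`∑ a n xⁿ` has at most `N` zeros in `ℤ_p`. -/
theorem strassmann_bound (p : ℕ) [Fact p.Prime] (a : ℕ → ℚ_[p])
    (ha : Tendsto (fun n => ‖a n‖) atTop (nhds 0)) (N : ℕ)
    (hsup : ‖a N‖ = ⨆ n : ℕ, ‖a n‖) (hN0 : ‖a N‖ ≠ 0)
    (hlt : ∀ n : ℕ, N < n → ‖a n‖ < ‖a N‖) :
    {x : ℤ_[p] | ∑' n : ℕ, a n * (x : ℚ_[p]) ^ n = 0}.encard ≤ N := by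
  refine strassmann_aux N a ha (fun n => ?_) (lt_of_le_of_ne (norm_nonneg _) hN0.symm) hlt
  rw [hsup]
  exact le_ciSup ha.bddAbove_range n
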